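/- Suppose F : ℝ^n × {t0, …, T} → ℝ is bounded, F(·, t) is measurable for each t, F(x, T) = c_T(x) for all x, and F(x, t) = inf_{u ∈ U} { c_t(x, u) + ∫ F(f(x, u, t, v), t+1) dγ(v) } for all x ∈ ℝ^n and t ∈ {t0, …, T−1}, where γ is the standard Gaussian measure on ℝ^q. Suppose further that the measurable policy θ : ℝ^n × ℕ → U attains this infimum: c_t(x, θ(x, t)) + ∫ F(f(x, θ(x, t), t, v), t+1) dγ(v) = F(x, t) for all x and t. Then for every initial state x0 and every measurable policy π : ℝ^n × ℕ → U, the expected cost of θ from (t0, x0) equals F(x0, t0) and is less than or equal to the expected cost of π from (t0, x0); that is, θ is an optimal policy for the stochastic problem. -/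

import Mathlib

open MeasureTheory ProbabilityTheory

/-- The standard Gaussian measure on `ℝ^q` (the `q`-fold product of the real Gaussian
measure with mean `0` and variance `1`). -/
noncomputable def gaussPi (q : ℕ) : Measure (Fin q → ℝ) :=
  Measure.pi fun _ => gaussianReal 0 1

/-- The law of the noise sequence `(v(t), …, v(t+L-1))`: the `L`-fold product of the
standard Gaussian measure on `ℝ^q`. -/
noncomputable def noiseMeasure (q L : ℕ) : Measure (Fin L → (Fin q → ℝ)) :=
  Measure.pi fun _ => gaussPi q

/-- The closed-loop state: `traj f π t x0 v k` is the state reached at time `t + k`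
starting from `x(t) = x0` and applying `x(s+1) = f(x(s), π(x(s), s), s, v(s))`, where
`v : Fin L → ℝ^q` is the noise realization (indexed so that `v ⟨k, _⟩` is the noise at
time `t + k`). -/
def traj {n m q : ℕ}
    (f : (Fin n → ℝ) → (Fin m → ℝ) → ℕ → (Fin q → ℝ) → (Fin n → ℝ))
    (π : (Fin n → ℝ) → ℕ → (Fin m → ℝ))
    (t : ℕ) (x0 : Fin n → ℝ) {L : ℕ} (v : Fin L → (Fin q → ℝ)) : ℕ → (Fin n → ℝ)
  | 0 => x0
  | k + 1 =>
      let xk := traj f π t x0 v k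
      f xk (π xk (t + k)) (t + k) (if h : k < L then v ⟨k, h⟩ else 0)

/-- The expected cost of the policy `π` started at time `t` from state `x0`:
the integral, with respect to the product Gaussian law of the noise sequence
`(v(t), …, v(T-1))`, of `Σ_{s=t}^{T-1} c_s(x(s), π(x(s), s)) + c_T(x(T))` along the
closed-loop trajectory. -/
noncomputable def ECost {n m q : ℕ} (T : ℕ)
    (f : (Fin n → ℝ) → (Fin m → ℝ) → ℕ → (Fin q → ℝ) → (Fin n → ℝ))
    (c : ℕ → (Fin n → ℝ) → (Fin m → ℝ) → ℝ) (cT : (Fin n → ℝ) → ℝ)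
    (π : (Fin n → ℝ) → ℕ → (Fin m → ℝ))
    (t : ℕ) (x0 : Fin n → ℝ) : ℝ :=
  ∫ v : Fin (T - t) → (Fin q → ℝ),
    ((∑ k ∈ Finset.range (T - t),
        c (t + k) (traj f π t x0 v k) (π (traj f π t x0 v k) (t + k))) +
      cT (traj f π t x0 v (T - t))) ∂(noiseMeasure q (T - t))

instance isProbabilityMeasure_gaussPi (q : ℕ) : IsProbabilityMeasure (gaussPi q) := by
  unfold gaussPi; infer_instance

instance isProbabilityMeasure_noiseMeasure (q L : ℕ) :
    IsProbabilityMeasure (noiseMeasure q L) := by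
  unfold noiseMeasure; infer_instance

/-- A bounded measurable real function is integrable for a finite measure. -/
theorem integrable_of_measurable_of_abs_le {α : Type*} [MeasurableSpace α] {μ : Measure α}
    [IsFiniteMeasure μ] {g : α → ℝ} (hg : Measurable g) {M : ℝ} (hM : ∀ a, |g a| ≤ M) :
    Integrable g μ :=
  Integrable.of_bound hg.aestronglyMeasurable M (ae_of_all _ hM)

/-- On a probability space, the integral of a function bounded by `M` is bounded by `M`. -/
theorem abs_integral_le_of_abs_le {α : Type*} [MeasurableSpace α] {μ : Measure α}
    [IsProbabilityMeasure μ] {g : α → ℝ} {M : ℝ} (hM : ∀ a, |g a| ≤ M) :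
    |∫ a, g a ∂μ| ≤ M := by
  simpa using norm_integral_le_of_norm_le_const (μ := μ) (f := g) (ae_of_all _ hM)

/-- Under a product measure, a coordinate may be integrated out with respect to its own law
when the other argument of the integrand does not depend on that coordinate. -/
theorem integral_pi_eq_integral_integral_of_update_eq {E X : Type*} [MeasurableSpace E]
    [MeasurableSpace X] (γ : Measure E) [IsProbabilityMeasure γ] {L : ℕ} (k : Fin L)
    {h : (Fin L → E) → X} (hh : Measurable h)
    (hk : ∀ v w, h (Function.update v k w) = h v)
    {G : X → E → ℝ} (hG : Measurable fun p : X × E => G p.1 p.2)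
    {M : ℝ} (hM : ∀ x e, |G x e| ≤ M) :
    ∫ v, G (h v) (v k) ∂(Measure.pi fun _ => γ) =
      ∫ v, ∫ w, G (h v) w ∂γ ∂(Measure.pi fun _ => γ) := by
  cases L with
  | zero => exact k.elim0
  | succ L =>
    obtain ⟨e₀⟩ := nonempty_of_isProbabilityMeasure γ
    have mp := (measurePreserving_piFinSuccAbove (fun _ : Fin (L + 1) => γ) k).symm
    have hins (w : E) (r : Fin L → E) :
        h (k.insertNth w r) = h (k.insertNth e₀ r) := by
      rw [← hk (k.insertNth e₀ r) w, Fin.update_insertNth]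
    have hbar : Measurable fun x => ∫ w, G x w ∂γ :=
      hG.stronglyMeasurable.integral_prod_right'.measurable
    have reduce {g : (Fin (L + 1) → E) → ℝ} (hg : Measurable g) (hgM : ∀ v, |g v| ≤ M) :
        ∫ v, g v ∂(Measure.pi fun _ => γ) =
          ∫ r, ∫ w, g (k.insertNth w r) ∂γ ∂(Measure.pi fun _ => γ) := by
      rw [← mp.integral_comp']
      exact integral_prod_symm _
        (integrable_of_measurable_of_abs_le (hg.comp mp.measurable) fun p => hgM _)
    rw [reduce (g := fun v => G (h v) (v k))
        (hG.comp (hh.prodMk (measurable_pi_apply k))) fun v => hM _ _,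
      reduce (g := fun v => ∫ w, G (h v) w ∂γ)
        (hbar.comp hh) fun v => abs_integral_le_of_abs_le (hM _)]
    simp only [Fin.insertNth_apply_same, hins, integral_const, probReal_univ, one_smul]

section Trajectory

variable {n m q : ℕ} {f : (Fin n → ℝ) → (Fin m → ℝ) → ℕ → (Fin q → ℝ) → (Fin n → ℝ)}
  {π : (Fin n → ℝ) → ℕ → (Fin m → ℝ)}

theorem measurable_traj
    (hf : ∀ t, Measurable fun p : (Fin n → ℝ) × (Fin m → ℝ) × (Fin q → ℝ) =>
      f p.1 p.2.1 t p.2.2)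
    (hπ : ∀ t, Measurable fun x => π x t) (t : ℕ) (x0 : Fin n → ℝ) (L k : ℕ) :
    Measurable fun v : Fin L → (Fin q → ℝ) => traj f π t x0 v k := by
  induction k with
  | zero => exact measurable_const
  | succ k ih =>
    have hv : Measurable fun v : Fin L → (Fin q → ℝ) => if h : k < L then v ⟨k, h⟩ else 0 := by
      split_ifs with h
      · exact measurable_pi_apply _
      · exact measurable_const
    exact (hf (t + k)).comp (ih.prodMk (((hπ (t + k)).comp ih).prodMk hv))

/-- The state after `j` steps does not depend on the noise at step `j` or later. -/
theorem traj_update_of_le (t : ℕ) (x0 : Fin n → ℝ) {L : ℕ} (v : Fin L → (Fin q → ℝ))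
    (k : Fin L) (w : Fin q → ℝ) {j : ℕ} (hj : j ≤ k) :
    traj f π t x0 (Function.update v k w) j = traj f π t x0 v j := by
  induction j with
  | zero => rfl
  | succ j ih =>
    have hjL : j < L := by omega
    have hne : (⟨j, hjL⟩ : Fin L) ≠ k := fun h => by simp [← h] at hj
    simp only [traj, ih (by omega), hjL, dite_true, Function.update_of_ne hne]

/-- The excess over `F x t` of the one-step cost of `π` at `(x, t)` with continuation `F`. -/
noncomputable def bellmanResidual
    (f : (Fin n → ℝ) → (Fin m → ℝ) → ℕ → (Fin q → ℝ) → (Fin n → ℝ))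
    (c : ℕ → (Fin n → ℝ) → (Fin m → ℝ) → ℝ) (F : (Fin n → ℝ) → ℕ → ℝ)
    (π : (Fin n → ℝ) → ℕ → (Fin m → ℝ)) (t : ℕ) (x : Fin n → ℝ) : ℝ :=
  c t x (π x t) + ∫ w, F (f x (π x t) t w) (t + 1) ∂(gaussPi q) - F x t

/-- Performance difference formula: the expected cost of a policy exceeds `F x0 t0` by the sum of
the expected Bellman residuals of `F` along the closed-loop trajectory. -/
theorem eCost_eq_add_sum_integral_residual {t0 T : ℕ} (ht0T : t0 ≤ T)
    (hf : ∀ t, Measurable fun p : (Fin n → ℝ) × (Fin m → ℝ) × (Fin q → ℝ) =>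
      f p.1 p.2.1 t p.2.2)
    {c : ℕ → (Fin n → ℝ) → (Fin m → ℝ) → ℝ}
    {Mc : ℝ} (hc_bdd : ∀ t x u, |c t x u| ≤ Mc)
    (hc_meas : ∀ t, Measurable fun p : (Fin n → ℝ) × (Fin m → ℝ) => c t p.1 p.2)
    {cT : (Fin n → ℝ) → ℝ} {F : (Fin n → ℝ) → ℕ → ℝ}
    {MF : ℝ} (hF_bdd : ∀ x t, |F x t| ≤ MF)
    (hF_meas : ∀ t, Measurable fun x => F x t)
    (hFT : ∀ x, F x T = cT x)
    (hπ : ∀ t, Measurable fun x => π x t) (x0 : Fin n → ℝ) :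
    ECost T f c cT π t0 x0 = F x0 t0 + ∑ k ∈ Finset.range (T - t0),
      ∫ v, bellmanResidual f c F π (t0 + k) (traj f π t0 x0 v k) ∂(noiseMeasure q (T - t0)) := by
  have hT : t0 + (T - t0) = T := by omega
  rw [← hT] at hFT
  unfold ECost
  generalize T - t0 = L at hFT ⊢
  have hx := measurable_traj hf hπ t0 x0 L
  have hcint (k : ℕ) : Integrable (fun v => c (t0 + k) (traj f π t0 x0 v k)
      (π (traj f π t0 x0 v k) (t0 + k))) (noiseMeasure q L) :=
    integrable_of_measurable_of_abs_le
      ((hc_meas _).comp ((hx k).prodMk ((hπ _).comp (hx k)))) fun v => hc_bdd _ _ _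
  have hFint (k : ℕ) : Integrable (fun v => F (traj f π t0 x0 v k) (t0 + k))
      (noiseMeasure q L) :=
    integrable_of_measurable_of_abs_le ((hF_meas _).comp (hx k)) fun v => hF_bdd _ _
  have hG (k : ℕ) : Measurable fun p : (Fin n → ℝ) × (Fin q → ℝ) =>
      F (f p.1 (π p.1 (t0 + k)) (t0 + k) p.2) (t0 + k + 1) :=
    (hF_meas _).comp ((hf _).comp
      (measurable_fst.prodMk (((hπ _).comp measurable_fst).prodMk measurable_snd)))
  have hbarint (k : ℕ) : Integrable (fun v => ∫ w, F (f (traj f π t0 x0 v k)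
      (π (traj f π t0 x0 v k) (t0 + k)) (t0 + k) w) (t0 + k + 1) ∂(gaussPi q))
      (noiseMeasure q L) :=
    integrable_of_measurable_of_abs_le
      ((hG k).stronglyMeasurable.integral_prod_right'.measurable.comp (hx k))
      fun v => abs_integral_le_of_abs_le fun w => hF_bdd _ _
  have hstep (k : ℕ) (hk : k < L) :
      ∫ v, F (traj f π t0 x0 v (k + 1)) (t0 + (k + 1)) ∂(noiseMeasure q L) =
        ∫ v, ∫ w, F (f (traj f π t0 x0 v k) (π (traj f π t0 x0 v k) (t0 + k)) (t0 + k) w)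
          (t0 + k + 1) ∂(gaussPi q) ∂(noiseMeasure q L) := by
    have := integral_pi_eq_integral_integral_of_update_eq (gaussPi q) ⟨k, hk⟩ (hx k)
      (fun v w => traj_update_of_le t0 x0 v ⟨k, hk⟩ w le_rfl)
      (G := fun x w => F (f x (π x (t0 + k)) (t0 + k) w) (t0 + k + 1))
      (hG k) fun x w => hF_bdd _ _
    simpa only [traj, hk, dite_true, noiseMeasure, add_assoc] using this
  have htel := Finset.sum_range_sub
    (fun k => ∫ v, F (traj f π t0 x0 v k) (t0 + k) ∂(noiseMeasure q L)) L
  have h0 : ∫ v, F (traj f π t0 x0 v 0) (t0 + 0) ∂(noiseMeasure q L) = F x0 t0 := by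
    simp [traj]
  have hres : ∀ k ∈ Finset.range L,
      ∫ v, bellmanResidual f c F π (t0 + k) (traj f π t0 x0 v k) ∂(noiseMeasure q L) =
      ∫ v, c (t0 + k) (traj f π t0 x0 v k)
          (π (traj f π t0 x0 v k) (t0 + k)) ∂(noiseMeasure q L) +
        (∫ v, F (traj f π t0 x0 v (k + 1)) (t0 + (k + 1)) ∂(noiseMeasure q L) -
          ∫ v, F (traj f π t0 x0 v k) (t0 + k) ∂(noiseMeasure q L)) := by
    intro k hk
    rw [hstep k (Finset.mem_range.1 hk), ← add_sub_assoc,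
      ← integral_add (hcint k) (hbarint k), ← integral_sub _ (hFint k)]
    · rfl
    · exact (hcint k).add (hbarint k)
  rw [Finset.sum_congr rfl hres, Finset.sum_add_distrib, htel, h0]
  simp only [← hFT]
  rw [integral_add (integrable_finsetSum _ fun k _ => hcint k) (hFint L),
    integral_finsetSum _ fun k _ => hcint k]
  ring

end Trajectory

/-- stochastic verification theorem.  If the bounded measurable function
`F` satisfies the terminal condition `F(x,T) = c_T(x)` and the stochastic Bellman
equation `F(x,t) = inf_{u ∈ U} { c_t(x,u) + ∫ F(f(x,u,t,v), t+1) dγ(v) }`, and the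
measurable `U`-valued policy `θ` attains this infimum everywhere, then for every
initial state `x0` the expected cost of `θ` from `(t0, x0)` equals `F(x0, t0)` and is
at most the expected cost of every measurable `U`-valued policy `π`; that is, `θ` is an
optimal policy for the stochastic problem. -/
theorem stochastic_bellman_policy_is_optimal
    {n m q : ℕ} (t0 T : ℕ) (ht0T : t0 < T)
    (f : (Fin n → ℝ) → (Fin m → ℝ) → ℕ → (Fin q → ℝ) → (Fin n → ℝ))
    (hf : ∀ t, Measurable fun p : (Fin n → ℝ) × (Fin m → ℝ) × (Fin q → ℝ) =>
      f p.1 p.2.1 t p.2.2)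
    (c : ℕ → (Fin n → ℝ) → (Fin m → ℝ) → ℝ)
    (hc_bdd : ∃ M, ∀ t x u, |c t x u| ≤ M)
    (hc_meas : ∀ t, Measurable fun p : (Fin n → ℝ) × (Fin m → ℝ) => c t p.1 p.2)
    (cT : (Fin n → ℝ) → ℝ)
    (hcT_bdd : ∃ M, ∀ x, |cT x| ≤ M)
    (hcT_meas : Measurable cT)
    (U : Set (Fin m → ℝ))
    (F : (Fin n → ℝ) → ℕ → ℝ)
    (hF_bdd : ∃ M, ∀ x t, |F x t| ≤ M)
    (hF_meas : ∀ t, Measurable fun x => F x t)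
    (hFT : ∀ x, F x T = cT x)
    (hBellman : ∀ x t, t0 ≤ t → t < T →
      F x t = sInf {r : ℝ |
        ∃ u ∈ U, c t x u + ∫ v, F (f x u t v) (t + 1) ∂(gaussPi q) = r})
    (θ : (Fin n → ℝ) → ℕ → (Fin m → ℝ))
    (hθU : ∀ x t, θ x t ∈ U)
    (hθ_meas : ∀ t, Measurable fun x => θ x t)
    (hθ_attains : ∀ x t, t0 ≤ t → t < T →
      c t x (θ x t) + ∫ v, F (f x (θ x t) t v) (t + 1) ∂(gaussPi q) = F x t) :
    ∀ x0 : Fin n → ℝ,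
      ECost T f c cT θ t0 x0 = F x0 t0 ∧
      ∀ π : (Fin n → ℝ) → ℕ → (Fin m → ℝ),
        (∀ t, Measurable fun x => π x t) → (∀ x t, π x t ∈ U) →
        ECost T f c cT θ t0 x0 ≤ ECost T f c cT π t0 x0 := by
  obtain ⟨Mc, hMc⟩ := hc_bdd
  obtain ⟨MF, hMF⟩ := hF_bdd
  intro x0
  have hθ : ECost T f c cT θ t0 x0 = F x0 t0 := by
    rw [eCost_eq_add_sum_integral_residual ht0T.le hf hMc hc_meas hMF hF_meas hFT hθ_meas,
      add_eq_left]
    refine Finset.sum_eq_zero fun k hk => ?_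
    have hk' := Finset.mem_range.1 hk
    exact integral_eq_zero_of_ae
      (ae_of_all _ fun v => sub_eq_zero.2 (hθ_attains _ _ (by omega) (by omega)))
  refine ⟨hθ, fun π hπ hπU => ?_⟩
  rw [hθ, eCost_eq_add_sum_integral_residual ht0T.le hf hMc hc_meas hMF hF_meas hFT hπ,
    le_add_iff_nonneg_right]
  refine Finset.sum_nonneg fun k hk => integral_nonneg fun v => sub_nonneg.2 ?_
  have hk' := Finset.mem_range.1 hk
  rw [hBellman _ _ (by omega) (by omega)]
  refine csInf_le ⟨-Mc + -MF, ?_⟩ ⟨_, hπU _ _, rfl⟩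
  rintro r ⟨u, -, rfl⟩
  exact add_le_add (neg_le_of_abs_le (hMc _ _ _))
    (neg_le_of_abs_le (abs_integral_le_of_abs_le fun w => hMF _ _))
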